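/- Let d ≥ 3 and x ∈ X_d. If the closure of the orbit A_d·x in X_d contains a compact A_d-orbit, then x is GFL. -/

import Mathlib

open scoped BigOperators

noncomputable section

/-- `SL_d(ℝ)`. -/
abbrev SLd (d : ℕ) := Matrix.SpecialLinearGroup (Fin d) ℝ

/-- The unimodular lattice `gℤ^d ⊆ ℝ^d`. -/
def latticeOf {d : ℕ} (g : SLd d) : Set (Fin d → ℝ) :=
  Set.range fun m : Fin d → ℤ => (g : Matrix (Fin d) (Fin d) ℝ).mulVec fun i => (m i : ℝ)

/-- A unimodular lattice in `ℝ^d` is a set of the form `gℤ^d` for some `g ∈ SL_d(ℝ)`. -/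
def IsUnimodularLattice {d : ℕ} (x : Set (Fin d → ℝ)) : Prop :=
  ∃ g : SLd d, x = latticeOf g

/-- The grid `x + v`. -/
def grid {d : ℕ} (x : Set (Fin d → ℝ)) (v : Fin d → ℝ) : Set (Fin d → ℝ) :=
  (fun u => u + v) '' x

/-- `N(y) = inf {|∏ i, w i| : w ∈ y}`. -/
def Ngrid {d : ℕ} (y : Set (Fin d → ℝ)) : ℝ :=
  sInf {r : ℝ | ∃ w ∈ y, r = |∏ i, w i|}

/-- The grid `x + v` is L (Littlewood): `inf {|n|·N(x + nv) : n ∈ ℤ, n ≠ 0} = 0`. -/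
def IsL {d : ℕ} (x : Set (Fin d → ℝ)) (v : Fin d → ℝ) : Prop :=
  sInf {r : ℝ | ∃ n : ℤ, n ≠ 0 ∧ r = |(n : ℝ)| * Ngrid (grid x ((n : ℝ) • v))} = 0

/-- The grid `x + v` is FL (L of finite type): `N(x + nv) = 0` for some nonzero integer `n`. -/
def IsFL {d : ℕ} (x : Set (Fin d → ℝ)) (v : Fin d → ℝ) : Prop :=
  ∃ n : ℤ, n ≠ 0 ∧ Ngrid (grid x ((n : ℝ) • v)) = 0

/-- A lattice `x` is GL if every grid `x + v` is L. -/
def IsGL {d : ℕ} (x : Set (Fin d → ℝ)) : Prop := ∀ v : Fin d → ℝ, IsL x v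

/-- A lattice `x` is GFL if every grid `x + v` is FL. -/
def IsGFL {d : ℕ} (x : Set (Fin d → ℝ)) : Prop := ∀ v : Fin d → ℝ, IsFL x v

/-- The topology on `SL_d(ℝ)` induced from the space of matrices. -/
instance (d : ℕ) : TopologicalSpace (SLd d) :=
  TopologicalSpace.induced (fun g : SLd d => (g : Matrix (Fin d) (Fin d) ℝ)) inferInstance

/-- Two elements of `SL_d(ℝ)` are identified iff they span the same lattice. -/
instance latSetoid (d : ℕ) : Setoid (SLd d) where
  r g h := latticeOf g = latticeOf h
  iseqv := ⟨fun _ => rfl, Eq.symm, Eq.trans⟩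

/-- The space `X_d` of unimodular lattices in `ℝ^d`, as the quotient `SL_d(ℝ)/SL_d(ℤ)`
with the quotient topology. -/
def XSp (d : ℕ) := Quotient (latSetoid d)

instance (d : ℕ) : TopologicalSpace (XSp d) := instTopologicalSpaceQuotient

/-- The lattice (a subset of `ℝ^d`) corresponding to a point of `X_d`. -/
def latticeOfX {d : ℕ} : XSp d → Set (Fin d → ℝ) := Quotient.lift latticeOf fun _ _ h => h

/-- `a ∈ A_d`: a diagonal matrix with positive diagonal entries (and determinant one,
since `a ∈ SL_d(ℝ)`). -/
def IsDiag {d : ℕ} (a : SLd d) : Prop :=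
  (∀ i, 0 < (a : Matrix (Fin d) (Fin d) ℝ) i i) ∧
    ∀ i j, i ≠ j → (a : Matrix (Fin d) (Fin d) ℝ) i j = 0

/-- The orbit `A_d · z ⊆ X_d` of a lattice `z ∈ X_d` under the group `A_d` of diagonal
matrices with positive entries and determinant one. -/
def Aorbit {d : ℕ} (z : XSp d) : Set (XSp d) :=
  {w | ∃ a g : SLd d, IsDiag a ∧ z = Quotient.mk (latSetoid d) g ∧
      w = Quotient.mk (latSetoid d) (a * g)}


/-- exponential action -/
def Eact {d : ℕ} (l v : Fin d → ℝ) : Fin d → ℝ := fun i => Real.exp (l i) * v i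

theorem Eact_add {d : ℕ} (l v w : Fin d → ℝ) : Eact l (v + w) = Eact l v + Eact l w := by
  funext i; simp [Eact, mul_add]

theorem Eact_sub {d : ℕ} (l v w : Fin d → ℝ) : Eact l (v - w) = Eact l v - Eact l w := by
  funext i; simp [Eact, mul_sub]

theorem Eact_smul {d : ℕ} (l v : Fin d → ℝ) (c : ℝ) : Eact l (c • v) = c • Eact l v := by
  funext i; simp [Eact]; ring

theorem Eact_comp {d : ℕ} (l m v : Fin d → ℝ) : Eact (l + m) v = Eact l (Eact m v) := by
  funext i; simp [Eact, Real.exp_add]; ring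

theorem Eact_zero {d : ℕ} (v : Fin d → ℝ) : Eact 0 v = v := by
  funext i; simp [Eact]

theorem Eact_neg_cancel {d : ℕ} (l v : Fin d → ℝ) : Eact (-l) (Eact l v) = v := by
  rw [← Eact_comp]; simp [Eact_zero]

theorem Eact_cancel_neg {d : ℕ} (l v : Fin d → ℝ) : Eact l (Eact (-l) v) = v := by
  rw [← Eact_comp]; simp [Eact_zero]

theorem Eact_cont {d : ℕ} (l : Fin d → ℝ) : Continuous (Eact l) := by
  unfold Eact; fun_prop

theorem Eact_prod {d : ℕ} (l v : Fin d → ℝ) (h : ∑ i, l i = 0) :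
    ∏ i, Eact l v i = ∏ i, v i := by
  simp [Eact, Finset.prod_mul_distrib, ← Real.exp_sum, h]

/-- the dynamical setup -/
structure Dyn {d : ℕ} (L Λ : AddSubgroup (Fin d → ℝ)) : Prop where
  disc : ∃ r > 0, ∀ l ∈ L, ‖l‖ < r → l = 0
  cocpt : ∃ R > 0, ∀ v : Fin d → ℝ, ∃ l ∈ L, ‖v - l‖ ≤ R
  sum : ∀ a ∈ Λ, ∑ i, a i = 0
  pres : ∀ a ∈ Λ, ∀ l ∈ L, Eact a l ∈ L
  co : ∃ C, ∀ a : Fin d → ℝ, ∑ i, a i = 0 → ∃ b ∈ Λ, ∀ i, |b i - a i| ≤ C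

/-- contraction vector -/
def cvec {d : ℕ} (i : Fin d) (s : ℝ) : Fin d → ℝ :=
  fun j => if j = i then -((d : ℝ) - 1) * s else s

theorem cvec_sum {d : ℕ} (i : Fin d) (s : ℝ) : ∑ j, cvec i s j = 0 := by
  unfold cvec
  rw [← Finset.add_sum_erase _ _ (Finset.mem_univ i)]
  have : ∑ x ∈ Finset.univ.erase i, (if x = i then -((d : ℝ) - 1) * s else s)
      = ∑ x ∈ Finset.univ.erase i, s := by
    apply Finset.sum_congr rfl
    intro x hx
    simp [Finset.ne_of_mem_erase hx]
  rw [this]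
  have h1 : 1 ≤ d := by have := i.2; omega
  simp [Finset.card_erase_of_mem]
  rw [Nat.cast_sub h1]
  push_cast
  ring

theorem exists_contr {r K C : ℝ} (hr : 0 < r) (hK : 0 ≤ K) :
    ∃ s : ℝ, Real.exp (C + s) * K < r := by
  refine ⟨Real.log (r / (K + 1)) - C, ?_⟩
  have : 0 < r / (K + 1) := by positivity
  rw [show C + (Real.log (r / (K + 1)) - C) = Real.log (r / (K + 1)) by ring, Real.exp_log this]
  rw [div_mul_eq_mul_div, div_lt_iff₀ (by positivity)]
  nlinarith

theorem coord_le {d : ℕ} (v : Fin d → ℝ) (i : Fin d) : |v i| ≤ ‖v‖ := by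
  simpa using norm_le_pi_norm v i

theorem Dyn.F1 {d : ℕ} {L Λ : AddSubgroup (Fin d → ℝ)} (D : Dyn L Λ) (i : Fin d)
    (l : Fin d → ℝ) (hl : l ∈ L) (h0 : l i = 0) : l = 0 := by
  obtain ⟨r, hr, hd⟩ := D.disc
  obtain ⟨C, hC⟩ := D.co
  obtain ⟨s, hs⟩ := exists_contr (C := C) hr (norm_nonneg l)
  obtain ⟨b, hb, hba⟩ := hC (cvec i s) (cvec_sum i s)
  have h1 : Eact b l = 0 := by
    apply hd _ (D.pres b hb l hl)
    rw [pi_norm_lt_iff hr]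
    intro j
    by_cases hj : j = i
    · subst hj; simp [Eact, h0, hr]
    · have h2 := hba j
      simp only [cvec, hj, if_false] at h2
      have h3 : b j ≤ C + s := by linarith [(abs_le.1 h2).2]
      simp only [Eact, Real.norm_eq_abs, abs_mul, Real.abs_exp]
      calc _ ≤ Real.exp (C + s) * ‖l‖ := by
            apply mul_le_mul (Real.exp_le_exp.2 h3) (coord_le l j) (abs_nonneg _)
              (Real.exp_pos _).le
        _ < r := hs
  rw [← Eact_neg_cancel b l, h1]
  funext j; simp [Eact]

theorem Dyn.exists_ne {d : ℕ} (hd : 0 < d) {L Λ : AddSubgroup (Fin d → ℝ)} (D : Dyn L Λ) :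
    ∃ l ∈ L, l ≠ 0 := by
  obtain ⟨R, hR, hco⟩ := D.cocpt
  obtain ⟨l, hl, h⟩ := hco (fun _ => R + 1)
  refine ⟨l, hl, ?_⟩
  rintro rfl
  have := coord_le ((fun _ => R + 1) - 0 : Fin d → ℝ) ⟨0, hd⟩
  simp only [sub_zero] at this h
  have h3 := le_abs_self (R + 1)
  linarith

theorem Dyn.F2 {d : ℕ} {L Λ : AddSubgroup (Fin d → ℝ)} (D : Dyn L Λ) (i : Fin d)
    (b : Fin d → ℝ) (hb : b ∈ Λ) (h0 : b i = 0) : b = 0 := by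
  have hd : 0 < d := by have := i.2; omega
  obtain ⟨l, hl, hne⟩ := D.exists_ne hd
  have h1 : Eact b l - l = 0 := by
    apply D.F1 i _ (L.sub_mem (D.pres b hb l hl) hl)
    simp [Eact, h0]
  funext j
  have h2 := congrFun h1 j
  have h3 : l j ≠ 0 := fun h => hne (D.F1 j l hl h)
  simp only [Eact, Pi.sub_apply, Pi.zero_apply] at h2
  have h4 : Real.exp (b j) = 1 := by
    have : (Real.exp (b j) - 1) * l j = 0 := by linarith
    rcases mul_eq_zero.1 this with h | h
    · linarith
    · exact absurd h h3
  simpa using h4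

theorem exists_orth {d : ℕ} (hd : 3 ≤ d) (w : Fin d → ℝ) :
    ∃ u : Fin d → ℝ, u ≠ 0 ∧ ∑ i, u i = 0 ∧ ∑ i, u i * w i = 0 := by
  let f : (Fin d → ℝ) →ₗ[ℝ] (ℝ × ℝ) :=
    LinearMap.prod (∑ i, LinearMap.proj i) (∑ i, w i • LinearMap.proj i)
  have h : LinearMap.ker f ≠ ⊥ := by
    apply LinearMap.ker_ne_bot_of_finrank_lt
    simp
    omega
  obtain ⟨u, hu, hne⟩ := (Submodule.ne_bot_iff _).1 h
  refine ⟨u, hne, ?_⟩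
  have h1 : f u = 0 := hu
  have h2 := congrArg Prod.fst h1
  have h3 := congrArg Prod.snd h1
  simp [f] at h2 h3
  refine ⟨h2, ?_⟩
  rw [← h3]
  exact Finset.sum_congr rfl fun i _ => mul_comm _ _

theorem Dyn.F3 {d : ℕ} (hd : 3 ≤ d) {L Λ : AddSubgroup (Fin d → ℝ)} (D : Dyn L Λ) (i : Fin d) :
    Dense ((fun b : Fin d → ℝ => b i) '' (Λ : Set (Fin d → ℝ))) := by
  rcases AddSubgroup.dense_or_cyclic (Λ.map (Pi.evalAddMonoidHom (fun _ : Fin d => ℝ) i)) with h | h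
  · exact h
  exfalso
  obtain ⟨a, ha⟩ := h
  have ha' : a ∈ Λ.map (Pi.evalAddMonoidHom (fun _ : Fin d => ℝ) i) := by
    rw [ha]; exact AddSubgroup.subset_closure rfl
  obtain ⟨w, hw, hwa⟩ := ha'
  have key : ∀ b ∈ Λ, ∃ n : ℤ, b = n • w := by
    intro b hb
    have : b i ∈ Λ.map (Pi.evalAddMonoidHom (fun _ : Fin d => ℝ) i) := ⟨b, hb, rfl⟩
    rw [ha, AddSubgroup.mem_closure_singleton] at this
    obtain ⟨n, hn⟩ := this
    refine ⟨n, ?_⟩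
    have := D.F2 i (b - n • w) (Λ.sub_mem hb (Λ.zsmul_mem hw n)) (by
      rw [← hwa] at hn
      simp at hn ⊢
      linarith)
    exact sub_eq_zero.1 this
  obtain ⟨u, hne, hu1, hu2⟩ := exists_orth hd w
  obtain ⟨C, hC⟩ := D.co
  have hS : 0 < ∑ j, u j * u j := by
    obtain ⟨j, hj⟩ := Function.ne_iff.1 hne
    apply Finset.sum_pos' (fun j _ => mul_self_nonneg _)
    exact ⟨j, Finset.mem_univ j, mul_self_pos.2 hj⟩
  set S := ∑ j, u j * u j
  set s := ((∑ j, |u j|) * C + 1) / S with hs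
  obtain ⟨b, hb, hba⟩ := hC (s • u) (by simp [← Finset.mul_sum, hu1])
  obtain ⟨n, rfl⟩ := key b hb
  have h1 : ∑ j, u j * ((s • u) j - (n • w) j) = s * S := by
    simp only [mul_sub, Finset.sum_sub_distrib, S, Finset.mul_sum]
    have : ∑ j, u j * (n • w) j = n * ∑ j, u j * w j := by
      rw [Finset.mul_sum]; apply Finset.sum_congr rfl; intro j _; simp; ring
    rw [this, hu2]
    simp
    apply Finset.sum_congr rfl; intro j _; ring
  have h2 : ∑ j, u j * ((s • u) j - (n • w) j) ≤ (∑ j, |u j|) * C := by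
    rw [Finset.sum_mul]
    apply Finset.sum_le_sum
    intro j _
    refine (le_abs_self _).trans ?_
    rw [abs_mul, abs_sub_comm]
    exact mul_le_mul_of_nonneg_left (hba j) (abs_nonneg _)
  have h3 : s * S = (∑ j, |u j|) * C + 1 := by rw [hs]; field_simp
  linarith

theorem pigeon {d : ℕ} (f : ℕ → Fin d → ℝ) (R : ℝ) (hf : ∀ k, ‖f k‖ ≤ R) {e : ℝ} (he : 0 < e) :
    ∃ m n, m < n ∧ ‖f m - f n‖ < e := by
  obtain ⟨a, -, φ, hφ, ht⟩ := (isCompact_closedBall (0 : Fin d → ℝ) R).tendsto_subseq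
    (x := f) (fun n => by simpa using hf n)
  have hc := ht.cauchySeq
  obtain ⟨N, hN⟩ := Metric.cauchySeq_iff.1 hc e he
  refine ⟨φ N, φ (N + 1), hφ (Nat.lt_succ_self N), ?_⟩
  have := hN N le_rfl (N + 1) (Nat.le_succ N)
  rwa [dist_eq_norm] at this

/-- invariant closed sets -/
structure InvSet {d : ℕ} (L Λ : AddSubgroup (Fin d → ℝ)) (M : Set (Fin d → ℝ)) : Prop where
  closed : IsClosed M
  per : ∀ w ∈ M, ∀ l ∈ L, w + l ∈ M
  inv : ∀ w ∈ M, ∀ b ∈ Λ, Eact b w ∈ M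

theorem Dyn.torsion {d : ℕ} {L Λ : AddSubgroup (Fin d → ℝ)} (D : Dyn L Λ)
    (w b : Fin d → ℝ) (hb : b ∈ Λ) (hb0 : b ≠ 0) (h : Eact b w - w ∈ L) :
    ∃ n : ℤ, n ≠ 0 ∧ (n : ℝ) • w ∈ L := by
  obtain ⟨r, hr, hdisc⟩ := D.disc
  obtain ⟨R, hR, hco⟩ := D.cocpt
  choose f hf hfR using fun k : ℕ => hco ((k : ℝ) • w)
  set u : ℕ → Fin d → ℝ := fun k => (k : ℝ) • w - f k
  have hcont : Continuous (fun x : Fin d → ℝ => Eact b x - x) := (Eact_cont b).sub continuous_id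
  have hev : ∃ e > 0, ∀ x : Fin d → ℝ, ‖x‖ < e → ‖Eact b x - x‖ < r := by
    obtain ⟨e, he, h1⟩ := Metric.continuous_iff.1 hcont 0 r hr
    refine ⟨e, he, fun x hx => ?_⟩
    have := h1 x (by simpa using hx)
    have h0 : Eact b (0 : Fin d → ℝ) = 0 := by funext j; simp [Eact]
    simpa [dist_eq_norm, h0] using this
  obtain ⟨e, he, hev⟩ := hev
  obtain ⟨m, n, hmn, hlt⟩ := pigeon u R hfR he
  have hz : Eact b (u m - u n) - (u m - u n) = 0 := by
    apply hdisc _ _ (hev _ hlt)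
    have : Eact b (u m - u n) - (u m - u n) = (((m : ℤ) - n : ℤ)) • (Eact b w - w)
        - (Eact b (f m) - f m) + (Eact b (f n) - f n) := by
      funext j
      simp [u, Eact]
      ring
    rw [this]
    refine L.add_mem (L.sub_mem (L.zsmul_mem h _) ?_) ?_
    · exact L.sub_mem (D.pres b hb _ (hf m)) (hf m)
    · exact L.sub_mem (D.pres b hb _ (hf n)) (hf n)
  have hu : u m - u n = 0 := by
    funext j
    have h1 := congrFun hz j
    have h2 : b j ≠ 0 := fun h => hb0 (D.F2 j b hb h)
    have h3 : Real.exp (b j) - 1 ≠ 0 := by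
      intro h; apply h2; rw [← Real.exp_eq_one_iff]; linarith
    have h4 : (Real.exp (b j) - 1) * (u m - u n) j = 0 := by
      simp only [Eact, Pi.sub_apply, Pi.zero_apply] at h1 ⊢; linarith
    exact (mul_eq_zero.1 h4).resolve_left h3
  refine ⟨(m : ℤ) - n, by omega, ?_⟩
  have : (((m : ℤ) - n : ℤ) : ℝ) • w = f m - f n := by
    funext j
    have := congrFun hu j
    simp [u] at this ⊢
    linarith
  rw [this]
  exact L.sub_mem (hf m) (hf n)

theorem Dyn.small {d : ℕ} (hd : 3 ≤ d) {L Λ : AddSubgroup (Fin d → ℝ)} (D : Dyn L Λ)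
    {M : Set (Fin d → ℝ)} (hM : InvSet L Λ M) (hne : M.Nonempty)
    (hnt : ∀ w ∈ M, ∀ n : ℤ, n ≠ 0 → (n : ℝ) • w ∉ L) {e : ℝ} (he : 0 < e) :
    ∃ w ∈ M, ∃ w' ∈ M, w - w' ≠ 0 ∧ ‖w - w'‖ < e := by
  obtain ⟨w, hw⟩ := hne
  obtain ⟨R, hR, hco⟩ := D.cocpt
  -- nonzero element of Λ
  obtain ⟨b, hb, hb0⟩ : ∃ b ∈ Λ, b ≠ 0 := by
    by_contra hcon
    push Not at hcon
    have := D.F3 hd ⟨0, by omega⟩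
    obtain ⟨x, hx, hx1⟩ := this.exists_gt 0
    obtain ⟨b, hb, rfl⟩ := hx
    rw [hcon b hb] at hx1
    simp at hx1
  choose f hf hfR using fun k : ℕ => hco (Eact (k • b) w)
  obtain ⟨m, n, hmn, hlt⟩ := pigeon _ R hfR he
  have hmem : ∀ k, Eact (k • b) w - f k ∈ M := by
    intro k
    rw [sub_eq_add_neg]
    exact hM.per _ (hM.inv w hw _ (Λ.nsmul_mem hb k)) _ (L.neg_mem (hf k))
  refine ⟨_, hmem m, _, hmem n, ?_, hlt⟩
  intro h0
  have h1 : Eact (n • b) w - Eact (m • b) w = f n - f m := by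
    funext j; have := congrFun h0 j; simp at this ⊢; linarith
  obtain ⟨k, rfl⟩ := Nat.exists_eq_add_of_lt hmn
  have h2 : Eact ((k + 1) • b) w - w ∈ L := by
    have h3 : Eact ((k + 1) • b) w - w = Eact (-(m • b)) (f (m + k + 1) - f m) := by
      rw [← h1, Eact_sub, Eact_neg_cancel, ← Eact_comp]
      congr 2
      rw [add_assoc, add_smul m]; abel
    rw [h3]
    exact D.pres _ (Λ.neg_mem (Λ.nsmul_mem hb _)) _ (L.sub_mem (hf _) (hf _))
  obtain ⟨z, hz, hzw⟩ := D.torsion w _ (Λ.nsmul_mem hb (k + 1)) (by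
    intro h
    apply hb0
    have := (smul_eq_zero.1 h)
    rcases this with h | h
    · omega
    · exact h) h2
  exact hnt w hw z hz hzw

theorem Dyn.axis {d : ℕ} (hd : 3 ≤ d) {L Λ : AddSubgroup (Fin d → ℝ)} (D : Dyn L Λ)
    {M : Set (Fin d → ℝ)} (hM : InvSet L Λ M)
    (hs : ∀ e > 0, ∃ v ∈ M, v ≠ 0 ∧ ‖v‖ < e) :
    ∃ i : Fin d, ∃ s : ℝ, s ≠ 0 ∧ Pi.single i s ∈ M := by
  obtain ⟨i, hi⟩ : ∃ i : Fin d, ∀ e > 0, ∃ v ∈ M, v i ≠ 0 ∧ ‖v‖ < e := by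
    by_contra hcon
    push Not at hcon
    choose e he hv using hcon
    have : Nonempty (Fin d) := ⟨⟨0, by omega⟩⟩
    obtain ⟨i0, hi0⟩ := Finite.exists_min e
    obtain ⟨v, hvM, hv0, hvn⟩ := hs (e i0) (he i0)
    obtain ⟨i, hvi⟩ := Function.ne_iff.1 hv0
    have := hv i v hvM hvi
    linarith [hi0 i]
  obtain ⟨C, hC⟩ := D.co
  have hd1 : (0 : ℝ) < (d : ℝ) - 1 := by
    have : (3 : ℝ) ≤ d := by exact_mod_cast hd
    linarith
  have step : ∀ e : ℝ, 0 < e → e ≤ 1 → ∃ w ∈ M, Real.exp (-C) ≤ |w i| ∧ |w i| ≤ Real.exp C ∧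
      ∀ j, j ≠ i → |w j| ≤ Real.exp C * e := by
    intro e he he1
    obtain ⟨v, hvM, hvi, hvn⟩ := hi e he
    have hvpos : 0 < |v i| := abs_pos.2 hvi
    have hlog : Real.log |v i| ≤ 0 :=
      Real.log_nonpos hvpos.le ((coord_le v i).trans (hvn.le.trans he1))
    obtain ⟨b, hb, hba⟩ := hC (cvec i (Real.log |v i| / ((d : ℝ) - 1))) (cvec_sum i _)
    refine ⟨Eact b v, hM.inv v hvM b hb, ?_, ?_, ?_⟩
    · have h1 := hba i
      have h2 : cvec i (Real.log |v i| / ((d : ℝ) - 1)) i = - Real.log |v i| := by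
        simp only [cvec, if_true]; field_simp
      rw [h2] at h1
      have h3 : -C + -Real.log |v i| ≤ b i := by linarith [(abs_le.1 h1).1]
      simp only [Eact, abs_mul, Real.abs_exp]
      calc Real.exp (-C) = Real.exp (-C + -Real.log |v i|) * |v i| := by
            rw [Real.exp_add, Real.exp_neg (Real.log _), Real.exp_log hvpos]; field_simp
        _ ≤ _ := mul_le_mul_of_nonneg_right (Real.exp_le_exp.2 h3) hvpos.le
    · have h1 := hba i
      have h2 : cvec i (Real.log |v i| / ((d : ℝ) - 1)) i = - Real.log |v i| := by
        simp only [cvec, if_true]; field_simp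
      rw [h2] at h1
      have h3 : b i ≤ C + -Real.log |v i| := by linarith [(abs_le.1 h1).2]
      simp only [Eact, abs_mul, Real.abs_exp]
      calc _ ≤ Real.exp (C + -Real.log |v i|) * |v i| :=
              mul_le_mul_of_nonneg_right (Real.exp_le_exp.2 h3) hvpos.le
        _ = _ := by
            rw [Real.exp_add, Real.exp_neg (Real.log _), Real.exp_log hvpos]; field_simp
    · intro j hj
      have h1 := hba j
      simp only [cvec, hj, if_false] at h1
      have h4 : Real.log |v i| / ((d : ℝ) - 1) ≤ 0 := div_nonpos_of_nonpos_of_nonneg hlog hd1.le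
      have h3 : b j ≤ C := by linarith [(abs_le.1 h1).2]
      simp only [Eact, abs_mul, Real.abs_exp]
      exact mul_le_mul (Real.exp_le_exp.2 h3) ((coord_le v j).trans hvn.le) (abs_nonneg _)
        (Real.exp_pos _).le
  choose w hwM hw1 hw2 hw3 using fun k : ℕ => step (1 / ((k : ℝ) + 1)) (by positivity) (by
    rw [div_le_one (by positivity)]; linarith [(Nat.cast_nonneg k : (0 : ℝ) ≤ k)])
  have hbd : ∀ k, w k ∈ Metric.closedBall (0 : Fin d → ℝ) (Real.exp C) := by
    intro k
    rw [mem_closedBall_zero_iff, pi_norm_le_iff_of_nonneg (Real.exp_pos _).le]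
    intro j
    by_cases hj : j = i
    · subst hj; exact hw2 k
    · refine (hw3 k j hj).trans ?_
      have : 1 / ((k : ℝ) + 1) ≤ 1 := by
        rw [div_le_one (by positivity)]; linarith [(Nat.cast_nonneg k : (0 : ℝ) ≤ k)]
      nlinarith [Real.exp_pos C]
  obtain ⟨a, -, φ, hφ, ht⟩ := (isCompact_closedBall (0 : Fin d → ℝ) _).tendsto_subseq hbd
  have haM : a ∈ M := hM.closed.mem_of_tendsto ht (Filter.Eventually.of_forall fun k => hwM _)
  have htj : ∀ j, Filter.Tendsto (fun k => |w (φ k) j|) Filter.atTop (nhds |a j|) := by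
    intro j
    exact ((continuous_abs.comp (continuous_apply j)).tendsto a).comp ht
  refine ⟨i, a i, ?_, ?_⟩
  · have : Real.exp (-C) ≤ |a i| :=
      ge_of_tendsto (htj i) (Filter.Eventually.of_forall fun k => hw1 _)
    have h5 := Real.exp_pos (-C)
    exact abs_pos.1 (lt_of_lt_of_le h5 this)
  · have : Pi.single i (a i) = a := by
      funext j
      by_cases hj : j = i
      · subst hj; simp
      · simp only [Pi.single_apply, hj, if_false]
        have h6 : Filter.Tendsto (fun k => Real.exp C * (1 / ((φ k : ℝ) + 1))) Filter.atTop
            (nhds (Real.exp C * 0)) :=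
          (tendsto_one_div_add_atTop_nhds_zero_nat.comp hφ.tendsto_atTop).const_mul _
        have h7 : |a j| ≤ Real.exp C * 0 := le_of_tendsto_of_tendsto' (htj j) h6
          (fun k => hw3 _ j hj)
        rw [mul_zero] at h7
        exact (abs_nonpos_iff.1 h7).symm
    rw [this]; exact haM

theorem Dyn.full {d : ℕ} (hd : 3 ≤ d) {L Λ : AddSubgroup (Fin d → ℝ)} (D : Dyn L Λ)
    {M : Set (Fin d → ℝ)} (hM : InvSet L Λ M)
    (hs : ∀ e > 0, ∃ v ∈ M, v ≠ 0 ∧ ‖v‖ < e) (p : Fin d → ℝ) : p ∈ M := by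
  obtain ⟨i, s, hs0, hsM⟩ := D.axis hd hM hs
  have half : ∀ c : ℝ, 0 < c → Pi.single i (c * s) ∈ M := by
    intro c hc
    have hcont : Continuous (fun x : ℝ => (Pi.single i (Real.exp x * s) : Fin d → ℝ)) := by
      have := continuous_single (A := fun _ : Fin d => ℝ) i
      exact this.comp (by fun_prop)
    have hcl := hM.closed.preimage hcont
    have hsub : closure ((fun b : Fin d → ℝ => b i) '' (Λ : Set (Fin d → ℝ))) ⊆
        (fun x : ℝ => (Pi.single i (Real.exp x * s) : Fin d → ℝ)) ⁻¹' M := by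
      apply closure_minimal _ hcl
      rintro _ ⟨b, hb, rfl⟩
      have := hM.inv _ hsM b hb
      have h2 : Eact b (Pi.single i s) = Pi.single i (Real.exp (b i) * s) := by
        funext j
        by_cases hj : j = i
        · subst hj; simp [Eact]
        · simp [Eact, hj]
      rw [h2] at this
      exact this
    have := hsub ((D.F3 hd i) (Real.log c))
    simpa [Real.exp_log hc] using this
  obtain ⟨R, hR, hco⟩ := D.cocpt
  obtain ⟨C, hC⟩ := D.co
  rw [← hM.closed.closure_eq, Metric.mem_closure_iff]
  intro e he
  obtain ⟨t, ht⟩ := exists_contr (C := C) he hR.le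
  obtain ⟨b, hb, hba⟩ := hC (cvec i t) (cvec_sum i t)
  obtain ⟨l, hl, hlR⟩ := hco (Eact (-b) p - Pi.single i ((R + 1) / |s| * s))
  set q := Eact (-b) p - Pi.single i ((R + 1) / |s| * s) - l with hq
  -- p - E b l = E b (single + q)
  have hsp : 0 < |s| := abs_pos.2 hs0
  have hqi : |q i| ≤ R := (coord_le q i).trans hlR
  set c := Real.exp (b i) * ((R + 1) / |s| + q i / s) with hc
  have hcpos : 0 < c := by
    apply mul_pos (Real.exp_pos _)
    have h1 : |q i / s| ≤ R / |s| := by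
      rw [abs_div]; exact div_le_div_of_nonneg_right hqi hsp.le
    have h2 : R / |s| < (R + 1) / |s| := div_lt_div_of_pos_right (by linarith) hsp
    linarith [(abs_le.1 h1).1]
  refine ⟨Pi.single i (c * s) + Eact b l, hM.per _ (half c hcpos) _ (D.pres b hb l hl), ?_⟩
  rw [dist_eq_norm, pi_norm_lt_iff he]
  have hp : p = Eact b (Pi.single i ((R + 1) / |s| * s) + q + l) := by
    rw [hq]
    rw [show Pi.single i ((R + 1) / |s| * s) +
      (Eact (-b) p - Pi.single i ((R + 1) / |s| * s) - l) + l = Eact (-b) p by abel,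
      Eact_cancel_neg]
  intro j
  by_cases hj : j = i
  · subst hj
    have : (p - ((Pi.single j (c * s) : Fin d → ℝ) + Eact b l)) j = 0 := by
      conv_lhs => rw [hp]
      simp [Eact, hc]
      field_simp
      ring
    rw [this]; simpa using he
  · have h2 : (p - ((Pi.single i (c * s) : Fin d → ℝ) + Eact b l)) j = Real.exp (b j) * q j := by
      conv_lhs => rw [hp]
      simp [Eact, hj]
      ring
    rw [h2]
    have h1 := hba j
    simp only [cvec, hj, if_false] at h1
    have h3 : b j ≤ C + t := by linarith [(abs_le.1 h1).2]
    simp only [Real.norm_eq_abs, abs_mul, Real.abs_exp]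
    calc _ ≤ Real.exp (C + t) * R := by
          apply mul_le_mul (Real.exp_le_exp.2 h3) ((coord_le q j).trans hlR) (abs_nonneg _)
            (Real.exp_pos _).le
      _ < e := ht

open scoped Pointwise in
/-- difference set -/
theorem Dyn.diff {d : ℕ} (hd : 3 ≤ d) {L Λ : AddSubgroup (Fin d → ℝ)} (D : Dyn L Λ)
    {M : Set (Fin d → ℝ)} (hM : InvSet L Λ M) (hne : M.Nonempty)
    (hnt : ∀ w ∈ M, ∀ n : ℤ, n ≠ 0 → (n : ℝ) • w ∉ L) (p : Fin d → ℝ) :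
    ∃ w ∈ M, w + p ∈ M := by
  obtain ⟨R, hR, hco⟩ := D.cocpt
  let K : Set (Fin d → ℝ) := {x | -x ∈ M ∧ ‖x‖ ≤ R}
  let S : Set (Fin d → ℝ) := {x | ∃ w ∈ M, ∃ w' ∈ M, x = w - w'}
  have hS : S = M + K := by
    ext x
    constructor
    · rintro ⟨w, hw, w', hw', rfl⟩
      obtain ⟨l, hl, hlR⟩ := hco w'
      refine Set.mem_add.2 ⟨w + -l, hM.per _ hw _ (L.neg_mem hl), -(w' + -l), ⟨?_, ?_⟩, by abel⟩
      · rw [neg_neg]; exact hM.per _ hw' _ (L.neg_mem hl)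
      · rw [norm_neg, ← sub_eq_add_neg]; exact hlR
    · intro hx
      obtain ⟨w, hw, k, hk, rfl⟩ := Set.mem_add.1 hx
      exact ⟨w, hw, -k, hk.1, by simp⟩
  have hK : IsCompact K := by
    have : K = Metric.closedBall 0 R ∩ (fun x => -x) ⁻¹' M := by
      ext x; simp [K, and_comm]
    rw [this]
    exact (isCompact_closedBall _ _).inter_right (hM.closed.preimage continuous_neg)
  have hSI : InvSet L Λ S := by
    refine ⟨?_, ?_, ?_⟩
    · rw [hS]; exact hM.closed.add_right_of_isCompact hK
    · rintro _ ⟨w, hw, w', hw', rfl⟩ l hl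
      exact ⟨w + l, hM.per w hw l hl, w', hw', by abel⟩
    · rintro _ ⟨w, hw, w', hw', rfl⟩ b hb
      exact ⟨_, hM.inv w hw b hb, _, hM.inv w' hw' b hb, Eact_sub _ _ _⟩
  have := D.full hd hSI (fun e he => by
    obtain ⟨w, hw, w', hw', h1, h2⟩ := D.small hd hM hne hnt he
    exact ⟨_, ⟨w, hw, w', hw', rfl⟩, h1, h2⟩) p
  obtain ⟨w, hw, w', hw', rfl⟩ := this
  exact ⟨w', hw', by simpa using hw⟩

theorem Dyn.minimal {d : ℕ} {L Λ : AddSubgroup (Fin d → ℝ)} (D : Dyn L Λ)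
    {M : Set (Fin d → ℝ)} (hM : InvSet L Λ M) (hne : M.Nonempty) :
    ∃ M' ⊆ M, InvSet L Λ M' ∧ M'.Nonempty ∧
      ∀ M'' ⊆ M', InvSet L Λ M'' → M''.Nonempty → M' ⊆ M'' := by
  obtain ⟨R, hR, hco⟩ := D.cocpt
  obtain ⟨m, hmM, hm⟩ := zorn_superset_nonempty {N | InvSet L Λ N ∧ N.Nonempty} (by
    intro c hc hchain hcne
    refine ⟨⋂₀ c, ⟨⟨?_, ?_, ?_⟩, ?_⟩, fun s hs => Set.sInter_subset_of_mem hs⟩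
    · exact isClosed_sInter fun s hs => (hc hs).1.closed
    · intro w hw l hl s hs
      exact (hc hs).1.per w (hw s hs) l hl
    · intro w hw b hb s hs
      exact (hc hs).1.inv w (hw s hs) b hb
    · have : Nonempty ((fun s => s ∩ Metric.closedBall (0 : Fin d → ℝ) R) '' c) := by
        obtain ⟨s, hs⟩ := hcne
        exact ⟨⟨_, s, hs, rfl⟩⟩
      have h := IsCompact.nonempty_sInter_of_directed_nonempty_isCompact_isClosed
        (S := (fun s => s ∩ Metric.closedBall (0 : Fin d → ℝ) R) '' c) (by
          rintro _ ⟨s, hs, rfl⟩ _ ⟨t, ht, rfl⟩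
          rcases hchain.total hs ht with h | h
          · exact ⟨_, ⟨s, hs, rfl⟩, subset_rfl, Set.inter_subset_inter_left _ h⟩
          · exact ⟨_, ⟨t, ht, rfl⟩, Set.inter_subset_inter_left _ h, subset_rfl⟩) (by
          rintro _ ⟨s, hs, rfl⟩
          obtain ⟨w, hw⟩ := (hc hs).2
          obtain ⟨l, hl, hlR⟩ := hco w
          refine ⟨w + -l, (hc hs).1.per w hw _ (L.neg_mem hl), ?_⟩
          rw [mem_closedBall_zero_iff, ← sub_eq_add_neg]; exact hlR) (by
          rintro _ ⟨s, hs, rfl⟩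
          exact (isCompact_closedBall _ _).inter_left (hc hs).1.closed) (by
          rintro _ ⟨s, hs, rfl⟩
          exact (hc hs).1.closed.inter Metric.isClosed_closedBall)
      obtain ⟨x, hx⟩ := h
      exact ⟨x, fun s hs => (hx _ ⟨s, hs, rfl⟩).1⟩) M ⟨hM, hne⟩
  exact ⟨m, hmM, hm.1.1, hm.1.2, fun M'' h1 h2 h3 => hm.2 ⟨h2, h3⟩ h1⟩

/-- congruence subgroup -/
def Dyn.congr {d : ℕ} {L Λ : AddSubgroup (Fin d → ℝ)} (D : Dyn L Λ) (t : ℕ) :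
    AddSubgroup (Fin d → ℝ) where
  carrier := {b | b ∈ Λ ∧ ∀ l ∈ L, ∃ l' ∈ L, Eact b l - l = (t : ℝ) • l'}
  zero_mem' := ⟨Λ.zero_mem, fun l _ => ⟨0, L.zero_mem, by simp [Eact_zero]⟩⟩
  add_mem' := by
    rintro a b ⟨ha, ha'⟩ ⟨hb, hb'⟩
    refine ⟨Λ.add_mem ha hb, fun l hl => ?_⟩
    obtain ⟨l1, h1, e1⟩ := hb' l hl
    obtain ⟨l2, h2, e2⟩ := ha' _ (D.pres b hb l hl)
    refine ⟨l2 + l1, L.add_mem h2 h1, ?_⟩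
    rw [smul_add, ← e1, ← e2, Eact_comp]; abel
  neg_mem' := by
    rintro b ⟨hb, hb'⟩
    refine ⟨Λ.neg_mem hb, fun l hl => ?_⟩
    obtain ⟨l1, h1, e1⟩ := hb' l hl
    refine ⟨-Eact (-b) l1, L.neg_mem (D.pres _ (Λ.neg_mem hb) _ h1), ?_⟩
    rw [smul_neg, ← Eact_smul, ← e1, Eact_sub, Eact_neg_cancel]; abel

theorem Dyn.congr_dyn {d : ℕ} {L Λ : AddSubgroup (Fin d → ℝ)} (D : Dyn L Λ) (t : ℕ) [NeZero t]
    (e : Fin d → Fin d → ℝ)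
    (hgen : ∀ l, l ∈ L ↔ ∃ m : Fin d → ℤ, l = ∑ j, (m j : ℝ) • e j) : Dyn L (D.congr t) := by
  refine ⟨D.disc, D.cocpt, fun a ha => D.sum a ha.1, fun a ha => D.pres a ha.1, ?_⟩
  have he : ∀ j, e j ∈ L := fun j => (hgen _).2 ⟨Pi.single j 1, by
    rw [Finset.sum_eq_single j]
    · simp
    · intro k _ hk; simp [hk]
    · simp⟩
  choose m hm using fun (b : Λ) (j : Fin d) => (hgen _).1 (D.pres b b.2 _ (he j))
  let φ : Λ → Fin d → Fin d → ZMod t := fun b j k => (m b j k : ZMod t)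
  have hφ : ∀ a b : Λ, φ a = φ b → (a : Fin d → ℝ) - b ∈ D.congr t := by
    intro a b hab
    have h1 : ∀ j, ∃ l' ∈ L, Eact a (e j) - Eact b (e j) = (t : ℝ) • l' := by
      intro j
      have h2 : ∀ k, ∃ z : ℤ, m a j k - m b j k = t * z := by
        intro k
        have := congrFun (congrFun hab j) k
        have h3 := (ZMod.intCast_eq_intCast_iff_dvd_sub _ _ t).1 this.symm
        exact h3
      choose z hz using h2
      refine ⟨∑ k, (z k : ℝ) • e k, (hgen _).2 ⟨z, rfl⟩, ?_⟩
      rw [hm a j, hm b j, ← Finset.sum_sub_distrib, Finset.smul_sum]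
      apply Finset.sum_congr rfl
      intro k _
      rw [← sub_smul, smul_smul]
      congr 1
      exact_mod_cast hz k
    choose l' hl' hl'e using h1
    refine ⟨Λ.sub_mem a.2 b.2, fun l hl => ?_⟩
    obtain ⟨n, rfl⟩ := (hgen l).1 hl
    refine ⟨Eact (-b) (∑ j, (n j : ℝ) • l' j), D.pres _ (Λ.neg_mem b.2) _ ?_, ?_⟩
    · refine L.sum_mem fun j _ => ?_
      have := L.zsmul_mem (hl' j) (n j)
      rwa [← Int.cast_smul_eq_zsmul ℝ] at this
    · rw [← Eact_smul, Finset.smul_sum]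
      have : ∀ j, (t : ℝ) • (n j : ℝ) • l' j = Eact a ((n j : ℝ) • e j) - Eact b ((n j : ℝ) • e j) := by
        intro j
        rw [smul_comm, ← hl'e, Eact_smul, Eact_smul, smul_sub]
      simp only [this, Finset.sum_sub_distrib]
      have hsum : ∀ c : Fin d → ℝ, ∑ j, Eact c ((n j : ℝ) • e j) = Eact c (∑ j, (n j : ℝ) • e j) := by
        intro c; funext i; simp [Eact, Finset.mul_sum]
      rw [hsum, hsum, Eact_sub, Eact_neg_cancel, ← Eact_comp, sub_eq_neg_add (a : Fin d → ℝ)]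
  obtain ⟨C, hC⟩ := D.co
  -- representatives
  have hrep : ∀ c : Set.range φ, ∃ b : Λ, φ b = c := fun c => c.2
  choose ρ hρ using hrep
  obtain ⟨B, hB⟩ : ∃ B : ℝ, ∀ c, ‖((ρ c : Λ) : Fin d → ℝ)‖ ≤ B := by
    obtain ⟨B, hB⟩ := (Set.finite_range (fun c => ‖((ρ c : Λ) : Fin d → ℝ)‖)).bddAbove
    exact ⟨B, fun c => hB ⟨c, rfl⟩⟩
  refine ⟨C + B, fun a ha => ?_⟩
  obtain ⟨b, hb, hba⟩ := hC a ha
  set c : Set.range φ := ⟨φ ⟨b, hb⟩, ⟨_, rfl⟩⟩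
  refine ⟨b - ρ c, hφ ⟨b, hb⟩ (ρ c) (hρ c).symm, fun i => ?_⟩
  have h1 := hba i
  have h2 := (coord_le _ i).trans (hB c)
  rw [abs_le] at *
  simp only [Pi.sub_apply]
  constructor <;> linarith

theorem Dyn.main {d : ℕ} (hd : 3 ≤ d) {L Λ : AddSubgroup (Fin d → ℝ)} (D : Dyn L Λ)
    (e : Fin d → Fin d → ℝ)
    (hgen : ∀ l, l ∈ L ↔ ∃ m : Fin d → ℤ, l = ∑ j, (m j : ℝ) • e j)
    (c : ℤ → ℝ) (hc : ∀ n, n ≠ 0 → 0 < c n) (w0 : Fin d → ℝ)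
    (hw0 : ∀ n : ℤ, n ≠ 0 → ∀ l ∈ L, c n ≤ |∏ i, ((n : ℝ) • w0 + l) i|) : False := by
  let M : Set (Fin d → ℝ) := {w | ∀ n : ℤ, n ≠ 0 → ∀ l ∈ L, c n ≤ |∏ i, ((n : ℝ) • w + l) i|}
  have hM : InvSet L Λ M := by
    refine ⟨?_, ?_, ?_⟩
    · simp only [M, Set.ofPred_forall]
      refine isClosed_iInter fun n => isClosed_iInter fun _ => isClosed_iInter fun l =>
        isClosed_iInter fun _ => ?_
      apply isClosed_le continuous_const
      simp only [Pi.add_apply, Pi.smul_apply]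
      fun_prop
    · intro w hw l hl n hn l' hl'
      have := hw n hn (n • l + l') (L.add_mem (L.zsmul_mem hl n) hl')
      rw [← Int.cast_smul_eq_zsmul ℝ, ← add_assoc, ← smul_add] at this
      exact this
    · intro w hw b hb n hn l hl
      have := hw n hn _ (D.pres _ (Λ.neg_mem hb) l hl)
      rw [← Eact_prod b _ (D.sum b hb), Eact_add, Eact_smul, Eact_cancel_neg] at this
      exact this
  have hnt : ∀ w ∈ M, ∀ n : ℤ, n ≠ 0 → (n : ℝ) • w ∉ L := by
    intro w hw n hn hL
    have := hw n hn _ (L.neg_mem hL)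
    have h2 := hc n hn
    rw [add_neg_cancel, Finset.prod_eq_zero (Finset.mem_univ ⟨0, by omega⟩) rfl] at this
    simp at this
    linarith
  obtain ⟨R, hR, hco⟩ := D.cocpt
  have key : ∀ t : ℕ, t ≠ 0 → ∃ w ∈ M, ‖w‖ ≤ R / t := by
    intro t ht
    have : NeZero t := ⟨ht⟩
    have D' := D.congr_dyn t e hgen
    have hM2 : InvSet L (D.congr t) M := ⟨hM.closed, hM.per, fun w hw b hb => hM.inv w hw b hb.1⟩
    obtain ⟨M', hsub, hI, hne, hmin⟩ := D'.minimal hM2 ⟨w0, hw0⟩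
    have htr : ∀ l ∈ L, ∀ w ∈ M', w + (t : ℝ)⁻¹ • l ∈ M' := by
      intro l hl
      have ht0 : (t : ℝ) ≠ 0 := by exact_mod_cast ht
      have := hmin {w | w ∈ M' ∧ w + (t : ℝ)⁻¹ • l ∈ M'} (fun w hw => hw.1) ⟨?_, ?_, ?_⟩ ?_
      · exact fun w hw => (this hw).2
      · exact hI.closed.inter (hI.closed.preimage (continuous_id.add continuous_const))
      · rintro w ⟨h1, h2⟩ l' hl'
        refine ⟨hI.per w h1 l' hl', ?_⟩
        have := hI.per _ h2 l' hl'
        rwa [add_right_comm] at this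
      · rintro w ⟨h1, h2⟩ b hb
        refine ⟨hI.inv w h1 b hb, ?_⟩
        have h3 := hI.inv _ h2 b hb
        obtain ⟨l', hl', he⟩ := hb.2 l hl
        have h4 := hI.per _ h3 _ (L.neg_mem hl')
        convert h4 using 1
        have : l' = (t : ℝ)⁻¹ • (Eact b l - l) := by
          rw [he, smul_smul, inv_mul_cancel₀ ht0, one_smul]
        rw [this, Eact_add, Eact_smul, smul_sub]
        abel
      · obtain ⟨w, h1, h2⟩ := D'.diff hd hI hne (fun w hw => hnt w (hsub hw)) ((t : ℝ)⁻¹ • l)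
        exact ⟨w, h1, h2⟩
    obtain ⟨w, hw⟩ := hne
    obtain ⟨l, hl, hlR⟩ := hco ((t : ℝ) • w)
    have ht0 : (0 : ℝ) < t := by positivity
    refine ⟨_, hsub (htr _ (L.neg_mem hl) w hw), ?_⟩
    have : w + (t : ℝ)⁻¹ • (-l) = (t : ℝ)⁻¹ • ((t : ℝ) • w - l) := by
      rw [smul_sub, smul_smul, inv_mul_cancel₀ ht0.ne', one_smul, smul_neg, sub_eq_add_neg]
    rw [this, norm_smul, norm_inv, Real.norm_of_nonneg ht0.le, div_eq_inv_mul]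
    exact mul_le_mul_of_nonneg_left hlR (by positivity)
  have hc1 := hc 1 one_ne_zero
  obtain ⟨t, ht⟩ := exists_nat_gt (max R (R / c 1))
  have ht1 : R < t := lt_of_le_of_lt (le_max_left _ _) ht
  have ht2 : R / c 1 < t := lt_of_le_of_lt (le_max_right _ _) ht
  have ht0 : (0 : ℝ) < t := hR.trans ht1
  obtain ⟨w, hw, hwn⟩ := key t (by rintro rfl; simp at ht0)
  have h1 := hw 1 one_ne_zero 0 L.zero_mem
  simp only [Int.cast_one, one_smul, add_zero, Finset.abs_prod] at h1
  have h2 : ∏ i, |w i| ≤ ∏ _i : Fin d, (R / t) :=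
    Finset.prod_le_prod (fun i _ => abs_nonneg _) (fun i _ => (coord_le w i).trans hwn)
  rw [Finset.prod_const, Finset.card_univ, Fintype.card_fin] at h2
  have h3 : (R / t) ^ d ≤ R / t := by
    apply pow_le_of_le_one (by positivity) _ (by omega)
    rw [div_le_one ht0]; exact ht1.le
  have h4 : R / t < c 1 := by
    rw [div_lt_iff₀ ht0]; rw [div_lt_iff₀ hc1] at ht2; linarith
  linarith

theorem mem_latticeOf {d : ℕ} (g : SLd d) (l : Fin d → ℝ) :
    l ∈ latticeOf g ↔
      ∃ m : Fin d → ℤ, l = (g : Matrix (Fin d) (Fin d) ℝ).mulVec fun i => (m i : ℝ) := by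
  simp [latticeOf, eq_comm]

theorem latticeOf_mul {d : ℕ} (a g : SLd d) :
    latticeOf (a * g) = (fun v => (a : Matrix (Fin d) (Fin d) ℝ).mulVec v) '' latticeOf g := by
  ext l
  simp [latticeOf, Matrix.mulVec_mulVec]

/-- the lattice as a subgroup -/
def latAdd {d : ℕ} (g : SLd d) : AddSubgroup (Fin d → ℝ) where
  carrier := latticeOf g
  zero_mem' := (mem_latticeOf g _).2 ⟨0, by simp [← Pi.zero_def]⟩
  add_mem' := by
    intro a b ha hb
    obtain ⟨m, rfl⟩ := (mem_latticeOf g _).1 ha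
    obtain ⟨n, rfl⟩ := (mem_latticeOf g _).1 hb
    refine (mem_latticeOf g _).2 ⟨m + n, ?_⟩
    rw [← Matrix.mulVec_add]; congr 1; funext i; simp
  neg_mem' := by
    intro a ha
    obtain ⟨m, rfl⟩ := (mem_latticeOf g _).1 ha
    refine (mem_latticeOf g _).2 ⟨-m, ?_⟩
    rw [← Matrix.mulVec_neg]; congr 1; funext i; simp

theorem inv_mulVec {d : ℕ} (g : SLd d) (v : Fin d → ℝ) :
    ((g⁻¹ : SLd d) : Matrix (Fin d) (Fin d) ℝ).mulVec
      ((g : Matrix (Fin d) (Fin d) ℝ).mulVec v) = v := by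
  rw [Matrix.mulVec_mulVec, ← Matrix.SpecialLinearGroup.coe_mul, inv_mul_cancel]; simp

theorem mulVec_inv {d : ℕ} (g : SLd d) (v : Fin d → ℝ) :
    (g : Matrix (Fin d) (Fin d) ℝ).mulVec
      (((g⁻¹ : SLd d) : Matrix (Fin d) (Fin d) ℝ).mulVec v) = v := by
  rw [Matrix.mulVec_mulVec, ← Matrix.SpecialLinearGroup.coe_mul, mul_inv_cancel]; simp

theorem mulVec_bound {d : ℕ} (g : Matrix (Fin d) (Fin d) ℝ) :
    ∃ K > 0, ∀ v : Fin d → ℝ, ‖g.mulVec v‖ ≤ K * ‖v‖ := by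
  refine ⟨‖LinearMap.toContinuousLinearMap (Matrix.toLin' g)‖ + 1, by positivity, fun v => ?_⟩
  have := (LinearMap.toContinuousLinearMap (Matrix.toLin' g)).le_opNorm v
  simp at this
  nlinarith [norm_nonneg v]

theorem lat_disc {d : ℕ} (g : SLd d) : ∃ r > 0, ∀ l ∈ latAdd g, ‖l‖ < r → l = 0 := by
  obtain ⟨K, hK, h⟩ := mulVec_bound ((g⁻¹ : SLd d) : Matrix (Fin d) (Fin d) ℝ)
  refine ⟨1 / K, by positivity, fun l hl hlr => ?_⟩
  obtain ⟨m, rfl⟩ := (mem_latticeOf g _).1 hl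
  have h1 := h ((g : Matrix (Fin d) (Fin d) ℝ).mulVec fun i => (m i : ℝ))
  rw [inv_mulVec] at h1
  rw [lt_div_iff₀ hK] at hlr
  have h2 : m = 0 := by
    funext i
    have h3 := coord_le (fun i => (m i : ℝ)) i
    have h4 : |(m i : ℝ)| < 1 := by linarith
    have h5 : |m i| < 1 := by exact_mod_cast h4
    simpa using Int.abs_lt_one_iff.1 h5
  subst h2
  simp [← Pi.zero_def]

theorem fract_rep {d : ℕ} (g : SLd d) (v : Fin d → ℝ) : ∃ (m : Fin d → ℤ) (f : Fin d → ℝ),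
    ‖f‖ ≤ 1 ∧ v = (g : Matrix (Fin d) (Fin d) ℝ).mulVec (f + fun i => (m i : ℝ)) := by
  set u := ((g⁻¹ : SLd d) : Matrix (Fin d) (Fin d) ℝ).mulVec v with hu
  refine ⟨fun i => ⌊u i⌋, fun i => Int.fract (u i), ?_, ?_⟩
  · rw [pi_norm_le_iff_of_nonneg zero_le_one]
    intro i
    rw [Real.norm_of_nonneg (Int.fract_nonneg _)]
    exact (Int.fract_lt_one _).le
  · have : ((fun i => Int.fract (u i)) + fun i => ((⌊u i⌋ : ℤ) : ℝ)) = u := by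
      funext i; simp [Int.fract_add_floor]
    rw [this, hu, mulVec_inv]

theorem lat_cocpt {d : ℕ} (g : SLd d) :
    ∃ R > 0, ∀ v : Fin d → ℝ, ∃ l ∈ latAdd g, ‖v - l‖ ≤ R := by
  obtain ⟨K, hK, h⟩ := mulVec_bound (g : Matrix (Fin d) (Fin d) ℝ)
  refine ⟨K, hK, fun v => ?_⟩
  obtain ⟨m, f, hf, hv⟩ := fract_rep g v
  refine ⟨_, (mem_latticeOf g _).2 ⟨m, rfl⟩, ?_⟩
  conv_lhs => rw [hv]
  rw [Matrix.mulVec_add, add_sub_cancel_right]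
  nlinarith [h f]

theorem lat_gen {d : ℕ} (g : SLd d) (l : Fin d → ℝ) : l ∈ latAdd g ↔
    ∃ m : Fin d → ℤ, l = ∑ j, (m j : ℝ) • (fun i => (g : Matrix (Fin d) (Fin d) ℝ) i j) := by
  refine (mem_latticeOf g l).trans (exists_congr fun m => ?_)
  have : ((g : Matrix (Fin d) (Fin d) ℝ).mulVec fun i => (m i : ℝ)) =
      ∑ j, (m j : ℝ) • (fun i => (g : Matrix (Fin d) (Fin d) ℝ) i j) := by
    funext i
    simp [Matrix.mulVec, dotProduct, mul_comm]
  rw [this]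

/-- hyperplane -/
def Hyp (d : ℕ) : AddSubgroup (Fin d → ℝ) where
  carrier := {l | ∑ i, l i = 0}
  zero_mem' := by simp
  add_mem' := by
    intro a b ha hb
    simp only [Set.mem_ofPred_eq, Pi.add_apply, Finset.sum_add_distrib] at *
    rw [ha, hb, add_zero]
  neg_mem' := by
    intro a ha
    simp only [Set.mem_ofPred_eq, Pi.neg_apply, Finset.sum_neg_distrib] at *
    rw [ha, neg_zero]

/-- exponential diagonal matrix -/
def diagE {d : ℕ} (l : Hyp d) : SLd d :=
  ⟨Matrix.diagonal fun i => Real.exp ((l : Fin d → ℝ) i), by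
    have : ∑ i, (l : Fin d → ℝ) i = 0 := l.2
    rw [Matrix.det_diagonal, ← Real.exp_sum, this, Real.exp_zero]⟩

theorem diagE_mulVec {d : ℕ} (l : Hyp d) (v : Fin d → ℝ) :
    (diagE l : Matrix (Fin d) (Fin d) ℝ).mulVec v = Eact l v := by
  funext i
  simp only [diagE, Matrix.mulVec_diagonal, Eact]

theorem diagE_mul {d : ℕ} (l m : Hyp d) : diagE l * diagE m = diagE (l + m) := by
  apply Subtype.ext
  change (Matrix.diagonal fun i => Real.exp ((l : Fin d → ℝ) i)) *
    (Matrix.diagonal fun i => Real.exp ((m : Fin d → ℝ) i)) = Matrix.diagonal fun i => Real.exp (((l + m : Hyp d) : Fin d → ℝ) i)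
  simp [Matrix.diagonal_mul_diagonal, Real.exp_add]

theorem diagE_isDiag {d : ℕ} (l : Hyp d) : IsDiag (diagE l) := by
  refine ⟨fun i => ?_, fun i j hij => ?_⟩
  · simp [diagE, Real.exp_pos]
  · simp [diagE, hij]

theorem IsDiag.exists_diagE {d : ℕ} {a : SLd d} (h : IsDiag a) : ∃ l : Hyp d, a = diagE l := by
  have hd : (a : Matrix (Fin d) (Fin d) ℝ) =
      Matrix.diagonal fun i => (a : Matrix (Fin d) (Fin d) ℝ) i i := by
    ext i j
    by_cases hij : i = j
    · subst hij; simp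
    · simp [hij, h.2 i j hij]
  have hdet : ∏ i, (a : Matrix (Fin d) (Fin d) ℝ) i i = 1 := by
    rw [← Matrix.det_diagonal, ← hd]; exact a.2
  refine ⟨⟨fun i => Real.log ((a : Matrix (Fin d) (Fin d) ℝ) i i), ?_⟩, ?_⟩
  · change ∑ i, _ = _
    rw [← Real.log_prod (fun i _ => (h.1 i).ne'), hdet, Real.log_one]
  · apply Subtype.ext
    refine hd.trans ?_
    change _ = Matrix.diagonal fun i => Real.exp (Real.log ((a : Matrix (Fin d) (Fin d) ℝ) i i))
    congr 1
    funext i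
    rw [Real.exp_log (h.1 i)]

theorem latticeOf_diagE {d : ℕ} (l : Hyp d) (g : SLd d) :
    latticeOf (diagE l * g) = Eact l '' latticeOf g := by
  rw [latticeOf_mul]
  simp only [diagE_mulVec]

/-- the projection -/
def prX {d : ℕ} (g : SLd d) : XSp d := Quotient.mk (latSetoid d) g

theorem prX_eq {d : ℕ} {g h : SLd d} : prX g = prX h ↔ latticeOf g = latticeOf h :=
  ⟨fun e => Quotient.exact e, fun e => Quotient.sound e⟩

theorem prX_mul {d : ℕ} {g h : SLd d} (a : SLd d) (e : prX g = prX h) :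
    prX (a * g) = prX (a * h) := by
  rw [prX_eq] at *
  rw [latticeOf_mul, latticeOf_mul, e]

theorem mem_Aorbit {d : ℕ} (g : SLd d) (w : XSp d) :
    w ∈ Aorbit (prX g) ↔ ∃ l : Hyp d, w = prX (diagE l * g) := by
  constructor
  · rintro ⟨a, h, ha, hz, hw⟩
    obtain ⟨l, rfl⟩ := ha.exists_diagE
    exact ⟨l, hw.trans (prX_mul _ hz.symm)⟩
  · rintro ⟨l, rfl⟩
    exact ⟨diagE l, g, diagE_isDiag l, rfl, rfl⟩

theorem topgrp (d : ℕ) : IsTopologicalGroup (SLd d) :=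
  @Matrix.SpecialLinearGroup.topologicalGroup (Fin d) ℝ _ _ _ _ _

theorem cont_coe (d : ℕ) : Continuous (fun g : SLd d => (g : Matrix (Fin d) (Fin d) ℝ)) :=
  continuous_induced_dom

theorem prX_cont (d : ℕ) : Continuous (prX : SLd d → XSp d) := continuous_quotient_mk'

theorem prX_surj (d : ℕ) : Function.Surjective (prX : SLd d → XSp d) := Quotient.mk_surjective

theorem prX_quot (d : ℕ) : Topology.IsQuotientMap (prX : SLd d → XSp d) := isQuotientMap_quot_mk

theorem prX_open (d : ℕ) : IsOpenMap (prX : SLd d → XSp d) := by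
  have := topgrp d
  intro U hU
  rw [← (prX_quot d).isOpen_preimage, isOpen_iff_mem_nhds]
  rintro h ⟨g, hg, hgh⟩
  have hc : Continuous (fun h' : SLd d => h' * (h⁻¹ * g)) := by fun_prop
  have hn : (fun h' : SLd d => h' * (h⁻¹ * g)) ⁻¹' U ∈ nhds h := by
    apply hc.continuousAt.preimage_mem_nhds
    simpa using hU.mem_nhds hg
  refine Filter.mem_of_superset hn ?_
  intro h' hh'
  refine ⟨_, hh', ?_⟩
  have := prX_mul (h' * h⁻¹) hgh
  simpa [mul_assoc] using this

theorem sub_iff {d : ℕ} (g h : SLd d) : latticeOf g ⊆ latticeOf h ↔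
    ∀ i j, ((h⁻¹ * g : SLd d) : Matrix (Fin d) (Fin d) ℝ) i j ∈ Set.range (Int.cast : ℤ → ℝ) := by
  have key : ∀ v, v ∈ latticeOf h ↔ ∃ m : Fin d → ℤ,
      ((h⁻¹ : SLd d) : Matrix (Fin d) (Fin d) ℝ).mulVec v = fun i => (m i : ℝ) := by
    intro v
    rw [mem_latticeOf]
    refine exists_congr fun m => ⟨?_, ?_⟩
    · rintro rfl; rw [inv_mulVec]
    · intro e; rw [← e, mulVec_inv]
  constructor
  · intro hs i j
    have h1 : (g : Matrix (Fin d) (Fin d) ℝ).mulVec (Pi.single j 1) ∈ latticeOf g := by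
      rw [mem_latticeOf]
      refine ⟨Pi.single j 1, ?_⟩
      congr 1; funext k
      by_cases hk : k = j
      · subst hk; simp
      · simp [hk]
    obtain ⟨m, hm⟩ := (key _).1 (hs h1)
    rw [Matrix.mulVec_mulVec, Matrix.mulVec_single_one] at hm
    exact ⟨m i, (congrFun hm i).symm⟩
  · intro hi v hv
    obtain ⟨n, rfl⟩ := (mem_latticeOf g v).1 hv
    choose B hB using hi
    rw [key]
    refine ⟨fun i => ∑ j, B i j * n j, ?_⟩
    rw [Matrix.mulVec_mulVec, ← Matrix.SpecialLinearGroup.coe_mul]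
    funext i
    simp [Matrix.mulVec, dotProduct, hB]

theorem X_t2 (d : ℕ) : T2Space (XSp d) := by
  have := topgrp d
  have hq : IsOpenQuotientMap (prX : SLd d → XSp d) := ⟨prX_surj d, prX_cont d, prX_open d⟩
  rw [t2Space_iff_of_isOpenQuotientMap hq]
  have hcl : ∀ f : SLd d × SLd d → SLd d, Continuous f → IsClosed {q : SLd d × SLd d | ∀ i j,
      ((f q : SLd d) : Matrix (Fin d) (Fin d) ℝ) i j ∈ Set.range (Int.cast : ℤ → ℝ)} := by
    intro f hf
    simp only [Set.ofPred_forall]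
    refine isClosed_iInter fun i => isClosed_iInter fun j => ?_
    refine Int.isClosedEmbedding_coe_real.isClosed_range.preimage (f := fun q => ((f q : SLd d) : Matrix (Fin d) (Fin d) ℝ) i j) ?_
    exact ((continuous_apply j).comp ((continuous_apply i).comp ((cont_coe d).comp hf)))
  have : {q : SLd d × SLd d | prX q.1 = prX q.2} =
    {q : SLd d × SLd d | ∀ i j, ((q.2⁻¹ * q.1 : SLd d) : Matrix (Fin d) (Fin d) ℝ) i j ∈ Set.range (Int.cast : ℤ → ℝ)} ∩
    {q : SLd d × SLd d | ∀ i j, ((q.1⁻¹ * q.2 : SLd d) : Matrix (Fin d) (Fin d) ℝ) i j ∈ Set.range (Int.cast : ℤ → ℝ)} := by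
    ext q
    simp only [Set.mem_inter_iff, Set.mem_ofPred_eq, prX_eq, ← sub_iff]
    exact Set.Subset.antisymm_iff
  rw [this]
  exact (hcl _ (by fun_prop)).inter (hcl _ (by fun_prop))

theorem diagE_cont (d : ℕ) : Continuous (diagE : Hyp d → SLd d) := by
  apply continuous_induced_rng.2
  change Continuous fun l : Hyp d => Matrix.diagonal fun i => Real.exp ((l : Fin d → ℝ) i)
  apply Continuous.matrix_diagonal
  refine continuous_pi fun i => Real.continuous_exp.comp ?_
  exact (continuous_apply i).comp continuous_subtype_val

/-- stabilizer -/
def stab {d : ℕ} (g : SLd d) : AddSubgroup (Fin d → ℝ) where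
  carrier := {b | ∑ i, b i = 0 ∧ (∀ l ∈ latAdd g, Eact b l ∈ latAdd g) ∧
    ∀ l ∈ latAdd g, Eact (-b) l ∈ latAdd g}
  zero_mem' := by simp [Eact_zero]
  add_mem' := by
    rintro a b ⟨ha, ha1, ha2⟩ ⟨hb, hb1, hb2⟩
    refine ⟨(Hyp d).add_mem ha hb, fun l hl => ?_, fun l hl => ?_⟩
    · rw [Eact_comp]; exact ha1 _ (hb1 l hl)
    · rw [neg_add, Eact_comp]; exact ha2 _ (hb2 l hl)
  neg_mem' := by
    rintro a ⟨ha, ha1, ha2⟩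
    refine ⟨(Hyp d).neg_mem ha, ha2, ?_⟩
    rwa [neg_neg]

theorem stab_of_eq {d : ℕ} (g : SLd d) (k l : Hyp d)
    (h : prX (diagE k * g) = prX (diagE l * g)) : (l : Fin d → ℝ) - (k : Fin d → ℝ) ∈ stab g := by
  rw [prX_eq, latticeOf_diagE, latticeOf_diagE] at h
  have aux : ∀ k l : Hyp d, Eact k '' latticeOf g = Eact l '' latticeOf g →
      ∀ x ∈ latAdd g, Eact ((l : Fin d → ℝ) - (k : Fin d → ℝ)) x ∈ latAdd g := by
    intro k l h x hx
    have h1 : Eact l x ∈ Eact k '' latticeOf g := by rw [h]; exact ⟨x, hx, rfl⟩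
    obtain ⟨y, hy, hyx⟩ := h1
    rw [sub_eq_neg_add, Eact_comp, ← hyx, Eact_neg_cancel]
    exact hy
  refine ⟨(Hyp d).sub_mem l.2 k.2, aux k l h, ?_⟩
  rw [neg_sub]
  exact aux l k h.symm

theorem orbit_co {d : ℕ} (g : SLd d) (hO : IsCompact (Aorbit (prX g))) :
    ∃ C, ∀ a : Fin d → ℝ, ∑ i, a i = 0 → ∃ b ∈ stab g, ∀ i, |b i - a i| ≤ C := by
  have := topgrp d
  have := X_t2 d
  set O := Aorbit (prX g) with hOdef
  let φ : Hyp d → XSp d := fun l => prX (diagE l * g)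
  have hφ : Continuous φ := by
    have := diagE_cont d
    exact (prX_cont d).comp (by fun_prop)
  have hφO : ∀ l, φ l ∈ O := fun l => (mem_Aorbit g _).2 ⟨l, rfl⟩
  have : CompactSpace O := isCompact_iff_compactSpace.1 hO
  have : Nonempty O := ⟨⟨φ 0, hφO 0⟩⟩
  have hK : ∀ n : ℕ, IsCompact {l : Hyp d | ‖(l : Fin d → ℝ)‖ ≤ n} := by
    intro n
    have hcl : IsClosed (Hyp d : Set (Fin d → ℝ)) := by
      change IsClosed {l : Fin d → ℝ | ∑ i, l i = 0}
      exact isClosed_eq (by fun_prop) continuous_const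
    have := hcl.isClosedEmbedding_subtypeVal.isCompact_preimage
      (isCompact_closedBall (0 : Fin d → ℝ) n)
    have he : {l : Hyp d | ‖(l : Fin d → ℝ)‖ ≤ n} =
        Subtype.val ⁻¹' Metric.closedBall (0 : Fin d → ℝ) n := by
      ext l; simp
    rw [he]; exact this
  obtain ⟨n, o, ho⟩ := nonempty_interior_of_iUnion_of_closed
    (f := fun n : ℕ => (Subtype.val ⁻¹' (φ '' {l : Hyp d | ‖(l : Fin d → ℝ)‖ ≤ n}) : Set O))
    (fun n => ((hK n).image hφ).isClosed.preimage continuous_subtype_val) (by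
      ext ⟨o, ho⟩
      simp only [Set.mem_iUnion, Set.mem_univ, iff_true]
      obtain ⟨l, rfl⟩ := (mem_Aorbit g _).1 ho
      obtain ⟨n, hn⟩ := exists_nat_ge ‖(l : Fin d → ℝ)‖
      exact ⟨n, l, hn, rfl⟩)
  rw [mem_interior] at ho
  obtain ⟨T, hT, hTo, hoT⟩ := ho
  obtain ⟨U, hU, rfl⟩ := isOpen_induced_iff.1 hTo
  obtain ⟨μ, hμ⟩ := (mem_Aorbit g _).1 o.2
  have hμU : φ μ ∈ U := by
    have : o.1 ∈ U := hoT
    rw [hμ] at this; exact this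
  let V : Hyp d → Set (XSp d) := fun a => prX '' {h | prX (diagE (-a) * h) ∈ U}
  obtain ⟨t, ht⟩ := hO.elim_finite_subcover V (fun a => by
      apply prX_open d
      apply hU.preimage (f := fun h => prX (diagE (-a) * h))
      exact (prX_cont d).comp (by fun_prop)) (by
      intro o ho
      obtain ⟨l, rfl⟩ := (mem_Aorbit g _).1 ho
      refine Set.mem_iUnion.2 ⟨l - μ, _, ?_, rfl⟩
      change prX _ ∈ U
      rw [← mul_assoc, diagE_mul]
      have : -(l - μ) + l = μ := by abel
      rw [this]; exact hμU)
  obtain ⟨B, hB⟩ : ∃ B : ℝ, ∀ a ∈ t, ‖(a : Fin d → ℝ)‖ ≤ B := by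
    obtain ⟨B, hB⟩ := (t.finite_toSet.image (fun a : Hyp d => ‖(a : Fin d → ℝ)‖)).bddAbove
    exact ⟨B, fun a ha => hB ⟨a, ha, rfl⟩⟩
  refine ⟨B + n, fun l0 hl0 => ?_⟩
  let l : Hyp d := ⟨l0, hl0⟩
  have h1 := ht (hφO l)
  simp only [Set.mem_iUnion] at h1
  obtain ⟨a, hat, h, hh, hhl⟩ := h1
  have h2 : φ (-a + l) ∈ U := by
    have h3 : prX (diagE (-a) * h) ∈ U := hh
    rw [prX_mul (diagE (-a)) hhl, ← mul_assoc, diagE_mul] at h3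
    exact h3
  obtain ⟨k, hk, hkl⟩ := hT (show (⟨φ (-a + l), hφO _⟩ : O) ∈ _ from h2)
  refine ⟨_, stab_of_eq g k (-a + l) hkl, fun i => ?_⟩
  have h4 := (coord_le _ i).trans (hB a hat)
  have h5 := (coord_le _ i).trans hk
  simp only [AddSubgroup.coe_add, AddSubgroup.coe_neg, Pi.sub_apply, Pi.add_apply, Pi.neg_apply, l]
  rw [abs_le] at *
  constructor <;> linarith

theorem orbit_dyn {d : ℕ} (g : SLd d) (hO : IsCompact (Aorbit (prX g))) :
    Dyn (latAdd g) (stab g) :=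
  ⟨lat_disc g, lat_cocpt g, fun _ ha => ha.1, fun _ ha => ha.2.1, orbit_co g hO⟩

theorem approx {d : ℕ} (g h0 : SLd d) (hcl : prX g ∈ closure (Aorbit (prX h0))) (e : ℝ)
    (he : 0 < e) : ∃ (u : SLd d) (l : Hyp d), latticeOf u = Eact l '' latticeOf h0 ∧
      ∀ i j, |(u : Matrix (Fin d) (Fin d) ℝ) i j - (g : Matrix (Fin d) (Fin d) ℝ) i j| < e := by
  let U : Set (SLd d) := {u | ∀ i j,
    |(u : Matrix (Fin d) (Fin d) ℝ) i j - (g : Matrix (Fin d) (Fin d) ℝ) i j| < e}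
  have hU : IsOpen U := by
    have : U = ⋂ i, ⋂ j, {u : SLd d |
      |(u : Matrix (Fin d) (Fin d) ℝ) i j - (g : Matrix (Fin d) (Fin d) ℝ) i j| < e} := by
      ext u; simp [U]
    rw [this]
    refine isOpen_iInter_of_finite fun i => isOpen_iInter_of_finite fun j => ?_
    apply isOpen_lt _ continuous_const
    have : Continuous (fun u : SLd d => (u : Matrix (Fin d) (Fin d) ℝ) i j) :=
      (continuous_apply j).comp ((continuous_apply i).comp (cont_coe d))
    fun_prop
  obtain ⟨y, ⟨u, hu, rfl⟩, hy⟩ := mem_closure_iff.1 hcl _ (prX_open d U hU)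
    ⟨g, by simp [U, he], rfl⟩
  obtain ⟨l, hl⟩ := (mem_Aorbit h0 _).1 hy
  rw [prX_eq, latticeOf_diagE] at hl
  exact ⟨u, l, hl, hu⟩

theorem limit_point {d : ℕ} (g h0 : SLd d) (hcl : prX g ∈ closure (Aorbit (prX h0)))
    (v : Fin d → ℝ) (c : ℤ → ℝ)
    (hv : ∀ n : ℤ, n ≠ 0 → ∀ l ∈ latAdd h0, c n ≤ |∏ i, ((n : ℝ) • v + l) i|) :
    ∃ w : Fin d → ℝ, ∀ n : ℤ, n ≠ 0 → ∀ l ∈ latAdd g, c n ≤ |∏ i, ((n : ℝ) • w + l) i| := by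
  choose u a hua hug using fun k : ℕ => approx g h0 hcl (1 / ((k : ℝ) + 1)) (by positivity)
  choose m f hf hvf using fun k : ℕ => fract_rep (u k) (Eact (a k) v)
  obtain ⟨f0, -, φ, hφ, ht⟩ := (isCompact_closedBall (0 : Fin d → ℝ) 1).tendsto_subseq
    (x := f) (fun k => by simpa using hf k)
  have hu : ∀ i j, Filter.Tendsto (fun k => (u (φ k) : Matrix (Fin d) (Fin d) ℝ) i j) Filter.atTop
      (nhds ((g : Matrix (Fin d) (Fin d) ℝ) i j)) := by
    intro i j
    rw [tendsto_iff_norm_sub_tendsto_zero]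
    refine squeeze_zero (fun k => norm_nonneg _) (fun k => (hug (φ k) i j).le) ?_
    exact tendsto_one_div_add_atTop_nhds_zero_nat.comp hφ.tendsto_atTop
  refine ⟨(g : Matrix (Fin d) (Fin d) ℝ).mulVec f0, fun n hn l hl => ?_⟩
  obtain ⟨p, rfl⟩ := (mem_latticeOf g _).1 hl
  have hlim : Filter.Tendsto (fun k => |∏ i, ((n : ℝ) • (u (φ k) : Matrix (Fin d) (Fin d) ℝ).mulVec (f (φ k))
      + (u (φ k) : Matrix (Fin d) (Fin d) ℝ).mulVec fun i => (p i : ℝ)) i|) Filter.atTop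
      (nhds |∏ i, ((n : ℝ) • (g : Matrix (Fin d) (Fin d) ℝ).mulVec f0
      + (g : Matrix (Fin d) (Fin d) ℝ).mulVec fun i => (p i : ℝ)) i|) := by
    apply Filter.Tendsto.abs
    apply tendsto_finsetProd
    intro i _
    simp only [Pi.add_apply, Pi.smul_apply, smul_eq_mul, Matrix.mulVec, dotProduct]
    refine Filter.Tendsto.add (Filter.Tendsto.const_mul _ (tendsto_finsetSum _ fun j _ => ?_))
      (tendsto_finsetSum _ fun j _ => (hu i j).mul_const _)
    exact (hu i j).mul ((tendsto_pi_nhds.1 ht) j)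
  refine ge_of_tendsto hlim (Filter.Eventually.of_forall fun k => ?_)
  generalize φ k = k
  have h1 : (u k : Matrix (Fin d) (Fin d) ℝ).mulVec (fun i => ((p i - n * m k i : ℤ) : ℝ))
      ∈ latticeOf (u k) := (mem_latticeOf _ _).2 ⟨_, rfl⟩
  rw [hua k] at h1
  obtain ⟨l', hl', hl'e⟩ := h1
  have h2 := hv n hn l' hl'
  have hs : ∑ i, (a k : Fin d → ℝ) i = 0 := (a k).2
  rw [← Eact_prod (a k) _ hs, Eact_add, Eact_smul, hl'e, hvf k, ← Matrix.mulVec_smul,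
    ← Matrix.mulVec_add] at h2
  rw [← Matrix.mulVec_smul, ← Matrix.mulVec_add]
  have h3 : ((n : ℝ) • f k + fun i => (p i : ℝ)) = ((n : ℝ) • (f k + fun i => (m k i : ℝ)) +
      fun i => ((p i - n * m k i : ℤ) : ℝ)) := by
    funext i
    simp only [Pi.add_apply, Pi.smul_apply, smul_eq_mul]
    push_cast
    ring
  rw [h3]
  exact h2

/-- For `d ≥ 3`, if the closure of the orbit `A_d · x` in `X_d` contains a compact
`A_d`-orbit, then `x` is GFL. -/
theorem stmt_17 (d : ℕ) (hd : 3 ≤ d) (x : XSp d)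
    (h : ∃ z : XSp d, IsCompact (Aorbit z) ∧ Aorbit z ⊆ closure (Aorbit x)) :
    IsGFL (latticeOfX x) := by
  obtain ⟨z, hz, hzx⟩ := h
  obtain ⟨g, rfl⟩ := prX_surj d z
  obtain ⟨h0, rfl⟩ := prX_surj d x
  intro v
  by_contra hcon
  have hN : ∀ n : ℤ, n ≠ 0 → Ngrid (grid (latticeOf h0) ((n : ℝ) • v)) ≠ 0 :=
    fun n hn h => hcon ⟨n, hn, h⟩
  have hpos : ∀ n : ℤ, n ≠ 0 → 0 < Ngrid (grid (latticeOf h0) ((n : ℝ) • v)) := by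
    intro n hn
    refine lt_of_le_of_ne (Real.sInf_nonneg ?_) (hN n hn).symm
    rintro _ ⟨w, -, rfl⟩
    exact abs_nonneg _
  have hv : ∀ n : ℤ, n ≠ 0 → ∀ l ∈ latAdd h0,
      Ngrid (grid (latticeOf h0) ((n : ℝ) • v)) ≤ |∏ i, ((n : ℝ) • v + l) i| := by
    intro n hn l hl
    apply csInf_le
    · refine ⟨0, ?_⟩
      rintro _ ⟨w, -, rfl⟩
      exact abs_nonneg _
    · exact ⟨_, ⟨l, hl, rfl⟩, by simp only [add_comm]⟩
  have hcl : prX g ∈ closure (Aorbit (prX h0)) := by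
    apply hzx
    refine (mem_Aorbit g _).2 ⟨0, ?_⟩
    rw [prX_eq, latticeOf_diagE]
    ext l
    simp [Eact_zero]
  obtain ⟨w, hw⟩ := limit_point g h0 hcl v _ hv
  exact (orbit_dyn g hz).main hd _ (lat_gen g) _ hpos w hw

end
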